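/- Let Ω be a properly convex quasi-homogeneous affine domain in ℝ⁴ whose asymptotic cone AC(Ω) is 1-dimensional (its linear span has dimension 1). Then Ω is affinely equivalent to the 4-dimensional paraboloid {(x₁,x₂,x₃,x₄) ∈ ℝ⁴ | x₄ > x₁² + x₂² + x₃²}. -/

import Mathlib

open Matrix Set Filter Topology Pointwise

noncomputable section

/-- The affine action on ℝⁿ of an (n+1)×(n+1) invertible matrix in affine form
(ℝⁿ is identified with the hyperplane x_{n+1} = 1). -/
def affAct (n : ℕ) (g : GL (Fin (n + 1)) ℝ) (x : Fin n → ℝ) : Fin n → ℝ :=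
  fun i => (∑ j : Fin n, g.val i.castSucc j.castSucc * x j) + g.val i.castSucc (Fin.last n)

/-- A matrix in GL(n+1,ℝ) has affine form if its last row is (0, …, 0, 1). -/
def IsAffineForm (n : ℕ) (g : GL (Fin (n + 1)) ℝ) : Prop :=
  (∀ j : Fin n, g.val (Fin.last n) j.castSucc = 0) ∧ g.val (Fin.last n) (Fin.last n) = 1

/-- Aut(Ω): the group (here: set) of affine transformations of ℝⁿ preserving Ω,
realized as affine-form matrices in GL(n+1,ℝ). -/
def AutSet (n : ℕ) (Ω : Set (Fin n → ℝ)) : Set (GL (Fin (n + 1)) ℝ) :=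
  {g | IsAffineForm n g ∧ affAct n g '' Ω = Ω}

/-- Aut⁰(Ω): the identity component of Aut(Ω). -/
def AutIdComp (n : ℕ) (Ω : Set (Fin n → ℝ)) : Set (GL (Fin (n + 1)) ℝ) :=
  connectedComponentIn (AutSet n Ω) 1

/-- The limit set Λ_G of a subset G of Aut(Ω). -/
def limitSet (n : ℕ) (Ω : Set (Fin n → ℝ)) (G : Set (GL (Fin (n + 1)) ℝ)) :
    Set (Fin n → ℝ) :=
  {ξ | ξ ∈ frontier Ω ∧ ∃ x ∈ Ω, ∃ u : ℕ → GL (Fin (n + 1)) ℝ,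
    (∀ k, u k ∈ G) ∧ Filter.Tendsto (fun k => affAct n (u k) x) Filter.atTop (nhds ξ)}

/-- Ω is a convex affine domain: a nonempty open convex subset of ℝⁿ. -/
def IsConvexDomain (n : ℕ) (Ω : Set (Fin n → ℝ)) : Prop :=
  Ω.Nonempty ∧ IsOpen Ω ∧ Convex ℝ Ω

/-- Ω contains no complete affine line. -/
def HasNoLine (n : ℕ) (Ω : Set (Fin n → ℝ)) : Prop :=
  ¬ ∃ x ∈ Ω, ∃ v : Fin n → ℝ, v ≠ 0 ∧ ∀ t : ℝ, x + t • v ∈ Ω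

/-- Ω is a properly convex affine domain. -/
def IsProperlyConvexDomain (n : ℕ) (Ω : Set (Fin n → ℝ)) : Prop :=
  IsConvexDomain n Ω ∧ HasNoLine n Ω

/-- Ω is quasi-homogeneous: some compact K ⊆ Ω has ⋃_{g ∈ Aut(Ω)} g(K) = Ω. -/
def IsQuasiHomogeneous (n : ℕ) (Ω : Set (Fin n → ℝ)) : Prop :=
  ∃ K : Set (Fin n → ℝ), IsCompact K ∧ K ⊆ Ω ∧
    (⋃ g ∈ AutSet n Ω, affAct n g '' K) = Ω

/-- Aut(Ω) is irreducible: it preserves no nonempty proper affine subspace of ℝⁿ. -/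
def IsIrreducibleAut (n : ℕ) (Ω : Set (Fin n → ℝ)) : Prop :=
  ¬ ∃ S : AffineSubspace ℝ (Fin n → ℝ), (S : Set (Fin n → ℝ)).Nonempty ∧
      (S : Set (Fin n → ℝ)) ≠ Set.univ ∧
      ∀ g ∈ AutSet n Ω, affAct n g '' (S : Set (Fin n → ℝ)) = (S : Set (Fin n → ℝ))

/-- The asymptotic cone AC(Ω). -/
def asympCone (n : ℕ) (Ω : Set (Fin n → ℝ)) : Set (Fin n → ℝ) :=
  {u | ∀ x ∈ Ω, ∀ t : ℝ, 0 ≤ t → x + t • u ∈ Ω}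

/-- Ω is a cone with some vertex v. -/
def IsCone (n : ℕ) (Ω : Set (Fin n → ℝ)) : Prop :=
  ∃ v : Fin n → ℝ, ∀ x ∈ Ω, ∀ t : ℝ, 0 < t → v + t • (x - v) ∈ Ω

/-- Two subsets of ℝⁿ are affinely equivalent. -/
def AffinelyEquivalent (n : ℕ) (Ω Ω' : Set (Fin n → ℝ)) : Prop :=
  ∃ e : (Fin n → ℝ) ≃ᵃ[ℝ] (Fin n → ℝ), e '' Ω = Ω'

/-- Γ acts freely on Ω. -/
def ActsFreely (n : ℕ) (Ω : Set (Fin n → ℝ)) (Γ : Set (GL (Fin (n + 1)) ℝ)) : Prop :=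
  ∀ γ ∈ Γ, γ ≠ 1 → ∀ x ∈ Ω, affAct n γ x ≠ x

/-- Γ acts properly discontinuously on Ω. -/
def ActsProperlyDiscontinuously (n : ℕ) (Ω : Set (Fin n → ℝ))
    (Γ : Set (GL (Fin (n + 1)) ℝ)) : Prop :=
  ∀ K L : Set (Fin n → ℝ), K ⊆ Ω → L ⊆ Ω → IsCompact K → IsCompact L →
    {γ ∈ Γ | (affAct n γ '' K ∩ L).Nonempty}.Finite

/-- Γ acts cocompactly on Ω. -/
def ActsCocompactly (n : ℕ) (Ω : Set (Fin n → ℝ)) (Γ : Set (GL (Fin (n + 1)) ℝ)) : Prop :=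
  ∃ K : Set (Fin n → ℝ), IsCompact K ∧ K ⊆ Ω ∧ (⋃ γ ∈ Γ, affAct n γ '' K) = Ω

/-- The linear part of an affine-form matrix has determinant one. -/
def LinearPartDetOne (n : ℕ) (g : GL (Fin (n + 1)) ℝ) : Prop :=
  (Matrix.of fun i j : Fin n => g.val i.castSucc j.castSucc).det = 1

set_option linter.unusedSectionVars false

section SecondDifference

variable {V : Type*} [NormedAddCommGroup V] [InnerProductSpace ℝ V]

/-- The symmetric second difference of `f` at `x` in direction `v`. -/
def secondDiff (f : V → ℝ) (x v : V) : ℝ := f (x + v) + f (x - v) - 2 * f x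

/-- The affine map with linear part `A` sending `y` to `z` multiplies the second differences
of `f` by `l`. -/
def SymAt (f : V → ℝ) (A : V →L[ℝ] V) (y z : V) (l : ℝ) : Prop :=
  ∀ u v, secondDiff f (z + A u) (A v) = l * secondDiff f (y + u) v

theorem SymAt.apply {f : V → ℝ} {A : V →L[ℝ] V} {y z : V} {l : ℝ} (h : SymAt f A y z l) (v : V) :
    secondDiff f z (A v) = l * secondDiff f y v := by
  simpa using h 0 v

theorem SymAt.rebase {f : V → ℝ} {A : V →L[ℝ] V} {y z : V} {l : ℝ} (h : SymAt f A y z l) (w : V) :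
    SymAt f A (y + w) (z + A w) l := by
  intro u v
  have := h (w + u) v
  rw [map_add, ← add_assoc, ← add_assoc] at this
  exact this

theorem SymAt.comp {f : V → ℝ} {A B : V →L[ℝ] V} {x y z : V} {l m : ℝ}
    (hB : SymAt f B y z m) (hA : SymAt f A x y l) : SymAt f (B * A) x z (m * l) := by
  intro u v
  have h1 := hB (A u) (A v)
  rw [hA u v] at h1
  simpa [mul_assoc] using h1

theorem SymAt.one (f : V → ℝ) (x : V) : SymAt f 1 x x 1 := by
  intro u v; simp

theorem SymAt.pow {f : V → ℝ} {A : V →L[ℝ] V} {x : V} {l : ℝ} (h : SymAt f A x x l) (n : ℕ) :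
    SymAt f (A ^ n) x x (l ^ n) := by
  induction n with
  | zero => simpa using SymAt.one f x
  | succ k ih => rw [pow_succ, pow_succ]; exact ih.comp h

theorem SymAt.inv {f : V → ℝ} {A B : V →L[ℝ] V} {y z : V} {l : ℝ} (h : SymAt f A y z l)
    (hl : l ≠ 0) (hAB : A * B = 1) : SymAt f B z y l⁻¹ := by
  intro u v
  have h1 := h (B u) (B v)
  have h2 : ∀ w, A (B w) = w := fun w => by
    have := congrArg (fun T : V →L[ℝ] V => T w) hAB
    simpa using this
  rw [h2, h2] at h1
  rw [h1, inv_mul_cancel_left₀ hl]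

theorem secondDiff_zero (f : V → ℝ) (x : V) : secondDiff f x 0 = 0 := by
  simp [secondDiff]; ring

theorem continuous_secondDiff {f : V → ℝ} (hf : Continuous f) :
    Continuous fun p : V × V => secondDiff f p.1 p.2 := by
  unfold secondDiff; fun_prop

theorem secondDiff_smul_le {f : V → ℝ} (hc : ConvexOn ℝ univ f) (x v : V) {t : ℝ} (h0 : 0 ≤ t)
    (h1 : t ≤ 1) : secondDiff f x (t • v) ≤ t * secondDiff f x v := by
  have e1 := hc.2 (mem_univ x) (mem_univ (x + v)) (sub_nonneg.2 h1) h0 (by ring)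
  have e2 := hc.2 (mem_univ x) (mem_univ (x - v)) (sub_nonneg.2 h1) h0 (by ring)
  have r1 : (1 - t) • x + t • (x + v) = x + t • v := by module
  have r2 : (1 - t) • x + t • (x - v) = x - t • v := by module
  rw [r1] at e1
  rw [r2] at e2
  simp only [secondDiff, smul_eq_mul] at *
  nlinarith

theorem secondDiff_nonneg {f : V → ℝ} (hc : ConvexOn ℝ univ f) (x v : V) :
    0 ≤ secondDiff f x v := by
  have e1 := hc.2 (mem_univ (x + v)) (mem_univ (x - v)) (by norm_num : (0 : ℝ) ≤ 1 / 2)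
    (by norm_num : (0 : ℝ) ≤ 1 / 2) (by norm_num)
  have r1 : (1 / 2 : ℝ) • (x + v) + (1 / 2 : ℝ) • (x - v) = x := by module
  rw [r1] at e1
  simp only [secondDiff, smul_eq_mul] at *
  linarith

theorem secondDiff_bounded {f : V → ℝ}
    (hg : ∀ p, ∃ T, ∀ w, T ≤ ‖w‖ → f p + ‖w‖ ≤ f (p + w)) (p : V) (C : ℝ) :
    ∃ R, 0 < R ∧ ∀ w, secondDiff f p w ≤ C → ‖w‖ ≤ R := by
  obtain ⟨T, hT⟩ := hg p
  refine ⟨max 1 (max T C), by positivity, fun w hw => ?_⟩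
  by_contra! hlt
  have h1 : 1 < ‖w‖ := lt_of_le_of_lt (le_max_left _ _) hlt
  have h2 : T < ‖w‖ := lt_of_le_of_lt ((le_max_left _ _).trans (le_max_right _ _)) hlt
  have h3 : C < ‖w‖ := lt_of_le_of_lt ((le_max_right _ _).trans (le_max_right _ _)) hlt
  have a1 := hT w h2.le
  have a2 := hT (-w) (by rw [norm_neg]; exact h2.le)
  rw [norm_neg, ← sub_eq_add_neg] at a2
  simp only [secondDiff] at hw
  linarith

theorem SymAt.injective {f : V → ℝ}
    (hg : ∀ p, ∃ T, ∀ w, T ≤ ‖w‖ → f p + ‖w‖ ≤ f (p + w))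
    {A : V →L[ℝ] V} {y z : V} {l : ℝ} (h : SymAt f A y z l) (hl : 0 < l) :
    Function.Injective A := by
  rw [injective_iff_map_eq_zero]
  intro v hv
  by_contra hne
  obtain ⟨R, hR, hb⟩ := secondDiff_bounded hg y 0
  obtain ⟨n, hn⟩ := exists_nat_gt (R / ‖v‖)
  have h1 := h.apply ((n : ℝ) • v)
  rw [map_smul, hv, smul_zero, secondDiff_zero] at h1
  have h2 : secondDiff f y ((n : ℝ) • v) = 0 := by
    rcases mul_eq_zero.1 h1.symm with h3 | h3
    · exact absurd h3 hl.ne'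
    · exact h3
  have := hb _ h2.le
  rw [norm_smul, Real.norm_natCast] at this
  rw [div_lt_iff₀ (norm_pos_iff.2 hne)] at hn
  linarith

variable [FiniteDimensional ℝ V]

theorem exists_two_sided_inverse {A : V →L[ℝ] V} (hA : Function.Injective A) :
    ∃ B : V →L[ℝ] V, A * B = 1 ∧ B * A = 1 := by
  let e := (LinearEquiv.ofInjectiveEndo (A : V →ₗ[ℝ] V) hA).toContinuousLinearEquiv
  have he : ∀ v, e v = A v := fun v => rfl
  refine ⟨e.symm, ?_, ?_⟩
  · ext v
    change A (e.symm v) = v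
    rw [← he]; simp
  · ext v
    change e.symm (A v) = v
    rw [← he]; simp

theorem exists_secondDiff_ge_sq {f : V → ℝ} (hf : Continuous f)
    (hg : ∀ p, ∃ T, ∀ w, T ≤ ‖w‖ → f p + ‖w‖ ≤ f (p + w)) :
    ∃ p, ∃ c > 0, ∃ r > 0, ∀ v, ‖v‖ ≤ r → c * ‖v‖ ^ 2 ≤ secondDiff f p v := by
  obtain ⟨T, hT⟩ := hg 0
  set R := max 1 T with hR
  have hR1 : 1 ≤ R := le_max_left _ _
  have hR0 : 0 < R := by linarith
  set F : V → ℝ := fun x => f x - 1 / (2 * R) * ‖x‖ ^ 2 with hF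
  have hFc : Continuous F := by rw [hF]; fun_prop
  obtain ⟨p, hp, hmin⟩ := (isCompact_closedBall (0 : V) R).exists_isMinOn
    ⟨0, by simpa using hR0.le⟩ hFc.continuousOn
  have hpR : ‖p‖ < R := by
    have hp' : ‖p‖ ≤ R := by simpa using hp
    refine lt_of_le_of_ne hp' fun h => ?_
    have h1 : F p ≤ F 0 := hmin (by simpa using hR0.le)
    have h2 := hT p (by rw [h]; exact le_max_right _ _)
    simp only [hF, zero_add, norm_zero] at h1 h2
    rw [h] at h1 h2
    have : 1 / (2 * R) * R ^ 2 = R / 2 := by field_simp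
    rw [this] at h1
    norm_num at h1
    linarith
  refine ⟨p, 1 / R, by positivity, R - ‖p‖, by linarith, fun v hv => ?_⟩
  have b1 : F p ≤ F (p + v) := hmin (by
    simp only [Metric.mem_closedBall, dist_zero_right]
    linarith [norm_add_le p v])
  have b2 : F p ≤ F (p - v) := hmin (by
    simp only [Metric.mem_closedBall, dist_zero_right]
    linarith [norm_sub_le p v])
  have hpar := parallelogram_law_with_norm ℝ p v
  simp only [hF] at b1 b2
  have : 1 / R * ‖v‖ ^ 2 = 1 / (2 * R) * ‖p + v‖ ^ 2 + 1 / (2 * R) * ‖p - v‖ ^ 2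
      - 2 * (1 / (2 * R) * ‖p‖ ^ 2) := by
    field_simp
    linarith
  rw [this]
  simp only [secondDiff]
  linarith

theorem exists_secondDiff_le_sq {f : V → ℝ} (hf : Continuous f) :
    ∃ p, ∃ c > 0, ∃ r > 0, ∀ v, ‖v‖ ≤ r → secondDiff f p v ≤ c * ‖v‖ ^ 2 := by
  obtain ⟨C, hC⟩ := (isCompact_closedBall (0 : V) 1).exists_bound_of_continuousOn
    hf.continuousOn
  have hC0 : 0 ≤ C := (norm_nonneg _).trans (hC 0 (by simp))
  set M := 2 * C + 1 with hM
  set F : V → ℝ := fun x => f x - M * ‖x‖ ^ 2 with hF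
  have hFc : Continuous F := by rw [hF]; fun_prop
  obtain ⟨p, hp, hmax⟩ := (isCompact_closedBall (0 : V) 1).exists_isMaxOn
    ⟨0, by simp⟩ hFc.continuousOn
  have hpR : ‖p‖ < 1 := by
    have hp' : ‖p‖ ≤ 1 := by simpa using hp
    refine lt_of_le_of_ne hp' fun h => ?_
    have h1 : F 0 ≤ F p := hmax (by simp)
    have h2 := abs_le.1 (hC p hp)
    have h3 := abs_le.1 (hC 0 (by simp))
    simp only [hF, norm_zero, h] at h1
    norm_num at h1
    linarith [h2.2, h3.1]
  refine ⟨p, 2 * M, by positivity, 1 - ‖p‖, by linarith, fun v hv => ?_⟩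
  have b1 : F (p + v) ≤ F p := hmax (by
    simp only [Metric.mem_closedBall, dist_zero_right]
    linarith [norm_add_le p v])
  have b2 : F (p - v) ≤ F p := hmax (by
    simp only [Metric.mem_closedBall, dist_zero_right]
    linarith [norm_sub_le p v])
  have hpar := parallelogram_law_with_norm ℝ p v
  simp only [hF] at b1 b2
  have : 2 * M * ‖v‖ ^ 2 = M * ‖p + v‖ ^ 2 + M * ‖p - v‖ ^ 2 - 2 * (M * ‖p‖ ^ 2) := by
    linear_combination -M * hpar
  rw [this]
  simp only [secondDiff]
  linarith

/-- Quasi-homogeneity of a convex function: up to its symmetries, every point at every scale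
lies in a compact range. -/
def QuasiHomFun (f : V → ℝ) : Prop :=
  ∃ K : Set V, IsCompact K ∧ ∃ a b : ℝ, 0 < a ∧ 0 < b ∧ ∀ x s, 0 < s →
    ∃ (A : V →L[ℝ] V) (k : V) (l : ℝ), k ∈ K ∧ 0 < l ∧ l * a ≤ s ∧ s ≤ l * b ∧ SymAt f A k x l

theorem exists_contraction {f : V → ℝ} (hc : ConvexOn ℝ univ f) (hf : Continuous f)
    (hg : ∀ p, ∃ T, ∀ w, T ≤ ‖w‖ → f p + ‖w‖ ≤ f (p + w)) (hq : QuasiHomFun f) :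
    ∃ (A : V →L[ℝ] V) (x : V) (l : ℝ), 0 < l ∧ ‖A‖ ≤ 1 / 2 ∧ SymAt f A x x l := by
  obtain ⟨K, hK, a, b, ha, hb, hqh⟩ := hq
  obtain ⟨p, c, hc0, r, hr, hpr⟩ := exists_secondDiff_ge_sq hf hg
  obtain ⟨C, hC⟩ := (hK.prod (isCompact_closedBall (0 : V) 1)).exists_bound_of_continuousOn
    (continuous_secondDiff hf).continuousOn
  set e := min r (1 / 4) with he
  have he0 : 0 < e := by positivity
  have her : e ≤ r := min_le_left _ _
  have he4 : e ≤ 1 / 4 := min_le_right _ _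
  set s := c * e ^ 2 * a / (2 * (|C| + 1)) with hs
  have hs0 : 0 < s := by positivity
  obtain ⟨A, k, l, hk, hl, hla, -, hA⟩ := hqh p s hs0
  have key : ∀ v, ‖v‖ ≤ 1 → ‖A v‖ ≤ e := by
    intro v hv
    by_contra! hlt
    have h1 : secondDiff f p (A v) ≤ l * (|C| + 1) := by
      rw [hA.apply]
      have := hC (k, v) ⟨hk, by simpa using hv⟩
      have h2 : secondDiff f k v ≤ |C| + 1 := by
        have := (le_abs_self _).trans this
        linarith [le_abs_self C]
      exact mul_le_mul_of_nonneg_left h2 hl.le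
    have hA0 : 0 < ‖A v‖ := he0.trans hlt
    have h3 := secondDiff_smul_le hc p (A v) (t := e / ‖A v‖) (by positivity)
      ((div_le_one hA0).2 hlt.le)
    have h4 : ‖(e / ‖A v‖) • A v‖ = e := by
      rw [norm_smul, Real.norm_of_nonneg (by positivity)]; field_simp
    have h5 := hpr _ (h4.le.trans her)
    rw [h4] at h5
    have h6 : e / ‖A v‖ * secondDiff f p (A v) ≤ secondDiff f p (A v) :=
      mul_le_of_le_one_left (secondDiff_nonneg hc _ _) ((div_le_one hA0).2 hlt.le)
    have h7 : c * e ^ 2 ≤ l * (|C| + 1) := by linarith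
    have h8 : l * (|C| + 1) ≤ c * e ^ 2 / 2 := by
      rw [hs, le_div_iff₀ (by positivity)] at hla
      have : a * (l * (|C| + 1)) ≤ a * (c * e ^ 2 / 2) := by linarith
      exact le_of_mul_le_mul_left this ha
    have : 0 < c * e ^ 2 := by positivity
    linarith
  have hAn : ‖A‖ ≤ 1 / 2 := by
    refine ContinuousLinearMap.opNorm_le_of_unit_norm (by norm_num) fun v hv => ?_
    linarith [key v hv.le]
  have hinj : Function.Injective ((1 - A : V →L[ℝ] V) : V →ₗ[ℝ] V) := by
    rw [injective_iff_map_eq_zero]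
    intro v hv
    have h1 : v = A v := by simpa [sub_eq_zero] using hv
    have h2 := A.le_opNorm v
    rw [← h1] at h2
    have h3 : ‖v‖ ≤ 0 := by nlinarith [norm_nonneg v]
    simpa using h3
  obtain ⟨x, hx⟩ := (LinearMap.injective_iff_surjective.1 hinj) (p - A k)
  have hx' : x - A x = p - A k := by simpa using hx
  refine ⟨A, x, l, hl, hAn, ?_⟩
  have := hA.rebase (x - k)
  rw [map_sub] at this
  have e1 : k + (x - k) = x := by abel
  have e2 : p + (A x - A k) = x := by
    rw [show p + (A x - A k) = (p - A k) + A x by abel, ← hx']; abel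
  rwa [e1, e2] at this

theorem norm_pow_apply_le {A : V →L[ℝ] V} (hA : ‖A‖ ≤ 1 / 2) (n : ℕ) (v : V) :
    ‖(A ^ n) v‖ ≤ (1 / 2) ^ n * ‖v‖ := by
  refine ((A ^ n).le_opNorm v).trans (mul_le_mul_of_nonneg_right ?_ (norm_nonneg _))
  rcases Nat.eq_zero_or_pos n with h | h
  · subst h; rw [pow_zero, pow_zero]; exact ContinuousLinearMap.norm_id_le
  · exact (norm_pow_le' A h).trans (pow_le_pow_left₀ (norm_nonneg _) hA n)

theorem symmetries_transitive {f : V → ℝ} (hf : Continuous f)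
    (hg : ∀ p, ∃ T, ∀ w, T ≤ ‖w‖ → f p + ‖w‖ ≤ f (p + w)) (hq : QuasiHomFun f)
    {A₀ : V →L[ℝ] V} {x : V} {l₀ : ℝ} (hl₀ : 0 < l₀) (hA₀ : ‖A₀‖ ≤ 1 / 2)
    (hs₀ : SymAt f A₀ x x l₀) (p : V) :
    ∃ (A : V →L[ℝ] V) (l : ℝ), 0 < l ∧ SymAt f A x p l := by
  obtain ⟨K, hK, a, b, ha, hb, hqh⟩ := hq
  obtain ⟨B, hAB, hBA⟩ := exists_two_sided_inverse (hs₀.injective hg hl₀)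
  have hABn : ∀ n : ℕ, A₀ ^ n * B ^ n = 1 := fun n => by
    rw [← (show Commute A₀ B from hAB.trans hBA.symm).mul_pow, hAB, one_pow]
  have hABnv : ∀ (n : ℕ) v, (A₀ ^ n) ((B ^ n) v) = v := fun n v => by
    simpa using congrArg (fun T : V →L[ℝ] V => T v) (hABn n)
  choose A k l hk hl hla hlb hA using fun j : ℕ => hqh (x + (B ^ j) (p - x)) 1 one_pos
  have hsym : ∀ j, SymAt f (A₀ ^ j * A j * B ^ j) (x + (A₀ ^ j) (k j - x)) p (l j) := by
    intro j
    have h0 := hs₀.pow j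
    have h1 := h0.rebase ((B ^ j) (p - x))
    rw [hABnv, add_sub_cancel] at h1
    have h2 := h0.rebase (k j - x)
    rw [add_sub_cancel] at h2
    have h3 := h2.inv (pow_pos hl₀ j).ne' (hABn j)
    have h4 := h1.comp ((hA j).comp h3)
    rw [← mul_assoc] at h4
    have e : l₀ ^ j * (l j * (l₀ ^ j)⁻¹) = l j := by
      have := (pow_pos hl₀ j).ne'
      field_simp
    rwa [e] at h4
  obtain ⟨r, hr⟩ := hK.isBounded.exists_norm_le
  have hxk : ∀ j, ‖(A₀ ^ j) (k j - x)‖ ≤ (1 / 2) ^ j * (r + ‖x‖) := fun j =>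
    (norm_pow_apply_le hA₀ j _).trans
      (mul_le_mul_of_nonneg_left ((norm_sub_le _ _).trans (by linarith [hr _ (hk j)]))
        (by positivity))
  have hxlim : Tendsto (fun j => x + (A₀ ^ j) (k j - x)) atTop (𝓝 x) := by
    have h1 : Tendsto (fun j : ℕ => ((1 : ℝ) / 2) ^ j * (r + ‖x‖)) atTop (𝓝 0) := by
      simpa using (tendsto_pow_atTop_nhds_zero_of_lt_one (r := (1 : ℝ) / 2) (by norm_num)
        (by norm_num)).mul_const (r + ‖x‖)
    simpa using (squeeze_zero_norm hxk h1).const_add x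
  have hl1 : ∀ j, l j ∈ Icc (1 / b) (1 / a) := fun j =>
    ⟨(div_le_iff₀ hb).2 (hlb j), (le_div_iff₀ ha).2 (hla j)⟩
  obtain ⟨C, hC⟩ := ((isCompact_closedBall x (r + ‖x‖)).prod
    (isCompact_closedBall (0 : V) 1)).exists_bound_of_continuousOn
      (continuous_secondDiff hf).continuousOn
  obtain ⟨R, hR, hRb⟩ := secondDiff_bounded hg p (1 / a * |C|)
  have hbd : ∀ j, ‖A₀ ^ j * A j * B ^ j‖ ≤ R := by
    intro j
    refine ContinuousLinearMap.opNorm_le_of_unit_norm hR.le fun v hv => hRb _ ?_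
    rw [(hsym j).apply]
    have hmem : (x + (A₀ ^ j) (k j - x), v) ∈
        Metric.closedBall x (r + ‖x‖) ×ˢ Metric.closedBall (0 : V) 1 := by
      refine ⟨?_, by simp [hv]⟩
      simp only [Metric.mem_closedBall, dist_eq_norm, add_sub_cancel_left]
      refine (hxk j).trans (mul_le_of_le_one_left ?_ (pow_le_one₀ (by norm_num) (by norm_num)))
      have := (norm_nonneg _).trans (hr _ (hk j))
      positivity
    have h1 := hC _ hmem
    calc l j * secondDiff f (x + (A₀ ^ j) (k j - x)) v ≤ l j * |C| :=
          mul_le_mul_of_nonneg_left (((le_abs_self _).trans h1).trans (le_abs_self C)) (hl j).le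
      _ ≤ 1 / a * |C| := mul_le_mul_of_nonneg_right (hl1 j).2 (abs_nonneg _)
  have : ProperSpace (V →L[ℝ] V) := FiniteDimensional.proper_real _
  obtain ⟨L, hL, φ, hφ, hlim⟩ := ((isCompact_closedBall (0 : V →L[ℝ] V) R).prod
    (isCompact_Icc (a := 1 / b) (b := 1 / a))).tendsto_subseq
      (x := fun j => (A₀ ^ j * A j * B ^ j, l j)) (fun j => ⟨by simpa using hbd j, hl1 j⟩)
  refine ⟨L.1, L.2, lt_of_lt_of_le (by positivity) hL.2.1, fun u v => ?_⟩
  have hA1 : Tendsto (fun j => A₀ ^ (φ j) * A (φ j) * B ^ (φ j)) atTop (𝓝 L.1) :=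
    (continuous_fst.tendsto _).comp hlim
  have hl2 : Tendsto (fun j => l (φ j)) atTop (𝓝 L.2) := (continuous_snd.tendsto _).comp hlim
  have ev : ∀ w : V, Tendsto (fun j => (A₀ ^ (φ j) * A (φ j) * B ^ (φ j)) w) atTop (𝓝 (L.1 w)) :=
    fun w => ((ContinuousLinearMap.apply ℝ V w).continuous.tendsto _).comp hA1
  have t1 := ((continuous_secondDiff hf).tendsto (p + L.1 u, L.1 v)).comp
    (((ev u).const_add p).prodMk_nhds (ev v))
  have t2 := hl2.mul (((continuous_secondDiff hf).tendsto (x + u, v)).comp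
    (((hxlim.comp hφ.tendsto_atTop).add_const u).prodMk_nhds tendsto_const_nhds))
  refine tendsto_nhds_unique t1 (t2.congr fun j => ?_)
  exact (hsym (φ j) u v).symm

theorem exists_sq_bounds {f : V → ℝ} (hf : Continuous f)
    (hg : ∀ p, ∃ T, ∀ w, T ≤ ‖w‖ → f p + ‖w‖ ≤ f (p + w)) {x : V}
    (htr : ∀ p, ∃ (A : V →L[ℝ] V) (l : ℝ), 0 < l ∧ SymAt f A x p l) :
    ∃ c > 0, ∃ C > 0, ∃ r > 0, ∀ v, ‖v‖ ≤ r →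
      c * ‖v‖ ^ 2 ≤ secondDiff f x v ∧ secondDiff f x v ≤ C * ‖v‖ ^ 2 := by
  obtain ⟨p, c, hc, r, hr, hp⟩ := exists_secondDiff_ge_sq hf hg
  obtain ⟨p', C, hC, r', hr', hp'⟩ := exists_secondDiff_le_sq hf
  obtain ⟨A, l, hl, hA⟩ := htr p
  obtain ⟨A', l', hl', hA'⟩ := htr p'
  obtain ⟨B, hAB, hBA⟩ := exists_two_sided_inverse (hA.injective hg hl)
  have hB : ∀ v, ‖v‖ ≤ (‖B‖ + 1) * ‖A v‖ := fun v => by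
    have h1 : B (A v) = v := by simpa using congrArg (fun T : V →L[ℝ] V => T v) hBA
    have h2 := B.le_opNorm (A v)
    rw [h1] at h2
    nlinarith [norm_nonneg (A v)]
  have hA1 : ∀ v, ‖A v‖ ≤ (‖A‖ + 1) * ‖v‖ := fun v => by
    nlinarith [A.le_opNorm v, norm_nonneg v]
  have hA1' : ∀ v, ‖A' v‖ ≤ (‖A'‖ + 1) * ‖v‖ := fun v => by
    nlinarith [A'.le_opNorm v, norm_nonneg v]
  refine ⟨c / (l * (‖B‖ + 1) ^ 2), by positivity, C * (‖A'‖ + 1) ^ 2 / l', by positivity,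
    min (r / (‖A‖ + 1)) (r' / (‖A'‖ + 1)), by positivity, fun v hv => ⟨?_, ?_⟩⟩
  · have h1 : ‖A v‖ ≤ r := by
      have := hv.trans (min_le_left _ _)
      rw [le_div_iff₀ (by positivity)] at this
      linarith [hA1 v]
    have h2 := hp _ h1
    rw [hA.apply] at h2
    have h3 : ‖v‖ ^ 2 ≤ (‖B‖ + 1) ^ 2 * ‖A v‖ ^ 2 := by
      rw [← mul_pow]; exact pow_le_pow_left₀ (norm_nonneg _) (hB v) 2
    rw [div_mul_eq_mul_div, div_le_iff₀ (by positivity)]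
    calc c * ‖v‖ ^ 2 ≤ c * ((‖B‖ + 1) ^ 2 * ‖A v‖ ^ 2) := by gcongr
      _ = (‖B‖ + 1) ^ 2 * (c * ‖A v‖ ^ 2) := by ring
      _ ≤ (‖B‖ + 1) ^ 2 * (l * secondDiff f x v) := by gcongr
      _ = _ := by ring
  · have h1 : ‖A' v‖ ≤ r' := by
      have := hv.trans (min_le_right _ _)
      rw [le_div_iff₀ (by positivity)] at this
      linarith [hA1' v]
    have h2 := hp' _ h1
    rw [hA'.apply] at h2
    have h3 : ‖A' v‖ ^ 2 ≤ (‖A'‖ + 1) ^ 2 * ‖v‖ ^ 2 := by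
      rw [← mul_pow]; exact pow_le_pow_left₀ (norm_nonneg _) (hA1' v) 2
    rw [div_mul_eq_mul_div, le_div_iff₀ (by positivity)]
    calc secondDiff f x v * l' = l' * secondDiff f x v := by ring
      _ ≤ C * ‖A' v‖ ^ 2 := h2
      _ ≤ C * ((‖A'‖ + 1) ^ 2 * ‖v‖ ^ 2) := by gcongr
      _ = _ := by ring

/-- A linear map whose powers are uniformly bi-Lipschitz is recurrent. -/
theorem exists_pow_near_one {B : V →L[ℝ] V} {m M : ℝ} (hm : 0 < m)
    (hlow : ∀ (n : ℕ) v, m * ‖v‖ ≤ ‖(B ^ n) v‖) (hup : ∀ (n : ℕ) v, ‖(B ^ n) v‖ ≤ M * ‖v‖)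
    (N : ℕ) {e : ℝ} (he : 0 < e) : ∃ n, N ≤ n ∧ ‖1 - B ^ n‖ ≤ e := by
  have hM : ∀ n : ℕ, ‖B ^ n‖ ≤ |M| := fun n => by
    refine ContinuousLinearMap.opNorm_le_bound _ (abs_nonneg _) fun v => (hup n v).trans ?_
    exact mul_le_mul_of_nonneg_right (le_abs_self M) (norm_nonneg _)
  have : ProperSpace (V →L[ℝ] V) := FiniteDimensional.proper_real _
  obtain ⟨L, -, φ, hφ, hlim⟩ := (isCompact_closedBall (0 : V →L[ℝ] V) |M|).tendsto_subseq
      (x := fun j => B ^ (N * j)) (fun j => by simpa using hM (N * j))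
  obtain ⟨k, hk⟩ := Metric.cauchySeq_iff'.1 hlim.cauchySeq (e * m) (by positivity)
  have h1 := hk (k + 1) (Nat.le_succ k)
  have hlt : φ k < φ (k + 1) := hφ (Nat.lt_succ_self k)
  obtain ⟨d, hd⟩ := Nat.exists_eq_add_of_lt hlt
  refine ⟨N * (d + 1), Nat.le_mul_of_pos_right _ (Nat.succ_pos d), ?_⟩
  refine ContinuousLinearMap.opNorm_le_bound _ he.le fun v => ?_
  have h2 := hlow (N * φ k) ((1 - B ^ (N * (d + 1)) : V →L[ℝ] V) v)
  have h3 : (B ^ (N * φ k)) ((1 - B ^ (N * (d + 1)) : V →L[ℝ] V) v) =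
      (B ^ (N * φ k) - B ^ (N * φ (k + 1)) : V →L[ℝ] V) v := by
    have : N * φ (k + 1) = N * φ k + N * (d + 1) := by rw [hd]; ring
    rw [this, pow_add, ← mul_apply_eq_comp, mul_sub, mul_one]
  rw [h3] at h2
  have h4 := (B ^ (N * φ k) - B ^ (N * φ (k + 1)) : V →L[ℝ] V).le_opNorm v
  rw [dist_comm, dist_eq_norm] at h1
  have h5 : m * ‖(1 - B ^ (N * (d + 1)) : V →L[ℝ] V) v‖ ≤ m * (e * ‖v‖) := by
    calc _ ≤ _ := h2.trans h4
      _ ≤ e * m * ‖v‖ := mul_le_mul_of_nonneg_right h1.le (norm_nonneg _)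
      _ = _ := by ring
  exact le_of_mul_le_mul_left h5 hm

theorem secondDiff_eq_of_quasiHom {f : V → ℝ} (hc : ConvexOn ℝ univ f) (hf : Continuous f)
    (hg : ∀ p, ∃ T, ∀ w, T ≤ ‖w‖ → f p + ‖w‖ ≤ f (p + w)) (hq : QuasiHomFun f) :
    ∃ x, ∀ p v, secondDiff f p v = secondDiff f x v := by
  obtain ⟨A₀, x, l₀, hl₀, hA₀, hs₀⟩ := exists_contraction hc hf hg hq
  have htr := symmetries_transitive hf hg hq hl₀ hA₀ hs₀
  obtain ⟨c, hc0, C, hC0, r, hr, hb⟩ := exists_sq_bounds hf hg htr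
  set q := √l₀ with hqdef
  have hq0 : 0 < q := Real.sqrt_pos.2 hl₀
  have hq2 : q ^ 2 = l₀ := Real.sq_sqrt hl₀.le
  set B : V →L[ℝ] V := q⁻¹ • A₀ with hB
  have hBn : ∀ (n : ℕ) v, (B ^ n) v = (A₀ ^ n) ((q ^ n)⁻¹ • v) := fun n v => by
    rw [hB, smul_pow, inv_pow, map_smul]; rfl
  have hAB : ∀ (n : ℕ) v, ‖(A₀ ^ n) v‖ ^ 2 = l₀ ^ n * ‖(B ^ n) v‖ ^ 2 := fun n v => by
    rw [hBn, map_smul, norm_smul, norm_inv, norm_pow, Real.norm_of_nonneg hq0.le, mul_pow,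
      inv_pow, ← pow_mul, mul_comm n 2, pow_mul, hq2, mul_inv_cancel_left₀ (pow_pos hl₀ n).ne']
  have hsmall : ∀ (n : ℕ) v, ‖v‖ ≤ r →
      c * ‖v‖ ^ 2 ≤ C * ‖(B ^ n) v‖ ^ 2 ∧ c * ‖(B ^ n) v‖ ^ 2 ≤ C * ‖v‖ ^ 2 := by
    intro n v hv
    have h1 : ‖(A₀ ^ n) v‖ ≤ r := (norm_pow_apply_le hA₀ n v).trans
      ((mul_le_of_le_one_left (norm_nonneg _) (pow_le_one₀ (by norm_num) (by norm_num))).trans hv)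
    obtain ⟨b1, b2⟩ := hb _ h1
    obtain ⟨b3, b4⟩ := hb _ hv
    rw [(hs₀.pow n).apply, hAB] at b1 b2
    have hp := pow_pos hl₀ n
    constructor
    · refine le_of_mul_le_mul_left (a := l₀ ^ n) ?_ hp
      nlinarith [mul_le_mul_of_nonneg_left b3 hp.le]
    · refine le_of_mul_le_mul_left (a := l₀ ^ n) ?_ hp
      nlinarith [mul_le_mul_of_nonneg_left b4 hp.le]
  have hall : ∀ (n : ℕ) v,
      c * ‖v‖ ^ 2 ≤ C * ‖(B ^ n) v‖ ^ 2 ∧ c * ‖(B ^ n) v‖ ^ 2 ≤ C * ‖v‖ ^ 2 := by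
    intro n v
    have ht : 0 < r / (‖v‖ + 1) := by positivity
    have hn : ‖(r / (‖v‖ + 1)) • v‖ ≤ r := by
      rw [norm_smul, Real.norm_of_nonneg ht.le, div_mul_eq_mul_div, div_le_iff₀ (by positivity)]
      nlinarith [norm_nonneg v]
    obtain ⟨h1, h2⟩ := hsmall n _ hn
    rw [map_smul, norm_smul, norm_smul, mul_pow, mul_pow, Real.norm_of_nonneg ht.le] at h1 h2
    have ht2 := pow_pos ht 2
    constructor
    · refine le_of_mul_le_mul_left (a := (r / (‖v‖ + 1)) ^ 2) ?_ ht2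
      linarith
    · refine le_of_mul_le_mul_left (a := (r / (‖v‖ + 1)) ^ 2) ?_ ht2
      linarith
  have hlow : ∀ (n : ℕ) v, √(c / C) * ‖v‖ ≤ ‖(B ^ n) v‖ := fun n v => by
    refine le_of_sq_le_sq ?_ (norm_nonneg _)
    rw [mul_pow, Real.sq_sqrt (by positivity), div_mul_eq_mul_div, div_le_iff₀ hC0]
    linarith [(hall n v).1]
  have hup : ∀ (n : ℕ) v, ‖(B ^ n) v‖ ≤ √(C / c) * ‖v‖ := fun n v => by
    refine le_of_sq_le_sq ?_ (by positivity)
    rw [mul_pow, Real.sq_sqrt (by positivity), div_mul_eq_mul_div, le_div_iff₀ hc0]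
    linarith [(hall n v).2]
  choose n hnN hn1 using fun i : ℕ => exists_pow_near_one (Real.sqrt_pos.2 (div_pos hc0 hC0))
    hlow hup (i + 1) (e := 1 / ((i : ℝ) + 1)) (by positivity)
  have hnlim : Tendsto n atTop atTop :=
    tendsto_atTop_mono (fun i => (Nat.le_succ i).trans (hnN i)) tendsto_id
  have hBlim : ∀ v, Tendsto (fun i => (B ^ n i) v) atTop (𝓝 v) := by
    intro v
    have h1 : Tendsto (fun i : ℕ => 1 / ((i : ℝ) + 1) * ‖v‖) atTop (𝓝 0) := by
      simpa using tendsto_one_div_add_atTop_nhds_zero_nat.mul_const ‖v‖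
    have h2 : Tendsto (fun i => (1 - B ^ n i : V →L[ℝ] V) v) atTop (𝓝 0) :=
      squeeze_zero_norm (fun i => ((1 - B ^ n i : V →L[ℝ] V).le_opNorm v).trans
        (mul_le_mul_of_nonneg_right (hn1 i) (norm_nonneg _))) h1
    have h3 := h2.const_sub v
    simpa using h3
  refine ⟨x, fun p => ?_⟩
  obtain ⟨A, l, hl, hA⟩ := htr p
  have hcD := continuous_secondDiff hf
  have hconj : ∀ i u v, secondDiff f (x + (A₀ ^ n i) (p - x) + (B ^ n i) (A u)) ((B ^ n i) (A v)) =
      l * secondDiff f (x + (B ^ n i) u) ((B ^ n i) v) := by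
    intro i u v
    have h0 := hs₀.pow (n i)
    have h1 := h0.rebase (p - x)
    rw [add_sub_cancel] at h1
    set t := (q ^ n i)⁻¹
    have h2 := h1 (A (t • u)) (A (t • v))
    rw [hA, mul_left_comm, ← h0 (t • u) (t • v)] at h2
    simpa [hBn] using h2
  have hlim0 : Tendsto (fun i => (A₀ ^ n i) (p - x)) atTop (𝓝 0) := by
    have h1 : Tendsto (fun j : ℕ => ((1 : ℝ) / 2) ^ j * ‖p - x‖) atTop (𝓝 0) := by
      simpa using (tendsto_pow_atTop_nhds_zero_of_lt_one (r := (1 : ℝ) / 2) (by norm_num)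
        (by norm_num)).mul_const ‖p - x‖
    exact (squeeze_zero_norm (fun j => norm_pow_apply_le hA₀ j (p - x)) h1).comp hnlim
  have hlin : ∀ u v, secondDiff f (x + A u) (A v) = l * secondDiff f (x + u) v := by
    intro u v
    have t0 : Tendsto (fun i => x + (A₀ ^ n i) (p - x) + (B ^ n i) (A u)) atTop
        (𝓝 (x + A u)) := by
      simpa using (hlim0.const_add x).add (hBlim (A u))
    have t1 := (hcD.tendsto (x + A u, A v)).comp (t0.prodMk_nhds (hBlim (A v)))
    have t2 := ((hcD.tendsto (x + u, v)).comp
      (((hBlim u).const_add x).prodMk_nhds (hBlim v))).const_mul l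
    exact tendsto_nhds_unique t1 (t2.congr fun i => (hconj i u v).symm)
  intro v
  obtain ⟨w, rfl⟩ := LinearMap.injective_iff_surjective (f := (A : V →ₗ[ℝ] V)) |>.1
    (hA.injective hg hl) v
  have h1 := hA.apply w
  have h2 := hlin 0 w
  simp only [map_zero, add_zero] at h2
  exact h1.trans h2.symm

/-- A continuous function with the parallelogram identity is a quadratic form. -/
theorem exists_quadraticForm_of_parallelogram {Q : V → ℝ} (hQ : Continuous Q)
    (h : ∀ u v, Q (u + v) + Q (u - v) = 2 * Q u + 2 * Q v) :
    ∃ q : QuadraticForm ℝ V, ∀ v, q v = Q v := by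
  have h0 : Q 0 = 0 := by have := h 0 0; simp at this; linarith
  have hadd : ∀ x x' y, QuadraticMap.polar Q (x + x') y =
      QuadraticMap.polar Q x y + QuadraticMap.polar Q x' y := by
    intro a b c
    have e1 := h (a + c) b
    have e2 := h (b + c) a
    have e3 := h c (a - b)
    have e4 := h a b
    rw [show a + c + b = a + b + c by abel] at e1
    rw [show b + c + a = a + b + c by abel, show b + c - a = c - (a - b) by abel] at e2
    rw [show c + (a - b) = a + c - b by abel] at e3
    simp only [QuadraticMap.polar]
    linarith
  have hsmul : ∀ (a : ℝ) x y, QuadraticMap.polar Q (a • x) y = a • QuadraticMap.polar Q x y := by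
    intro a x y
    have hc : Continuous fun z => QuadraticMap.polar Q z y := by
      unfold QuadraticMap.polar; fun_prop
    exact map_real_smul (AddMonoidHom.mk' (fun z => QuadraticMap.polar Q z y)
      fun u v => hadd u v y) hc a x
  have hself : ∀ x, QuadraticMap.polar Q x x = 2 * Q x := by
    intro x
    have := h x x
    rw [sub_self, h0] at this
    simp only [QuadraticMap.polar]
    linarith
  refine ⟨QuadraticMap.ofPolar Q (fun a x => ?_) hadd hsmul, fun v => rfl⟩
  have h1 := hself (a • x)
  rw [hsmul, QuadraticMap.polar_comm, hsmul, hself] at h1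
  simp only [smul_eq_mul] at h1 ⊢
  linarith

theorem exists_sum_sq_of_posDef {q : QuadraticForm ℝ V} (hq : ∀ v, v ≠ 0 → 0 < q v) :
    ∃ e : V ≃ₗ[ℝ] (Fin (Module.finrank ℝ V) → ℝ), ∀ v, q v = ∑ i, e v i ^ 2 := by
  obtain ⟨w, ⟨e⟩⟩ := QuadraticForm.equivalent_signType_weighted_sum_squared q
  have hw : ∀ i, w i = 1 := by
    intro i
    have h1 := hq (e.symm (Pi.single i 1)) (by
      intro h
      have h2 := congrArg e h
      rw [QuadraticMap.IsometryEquiv.apply_symm_apply, map_zero] at h2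
      have := congrFun h2 i
      simp at this)
    rw [QuadraticMap.IsometryEquiv.map_app, QuadraticMap.weightedSumSquares_apply,
      Finset.sum_eq_single i (fun j _ hj => by simp [Pi.single_eq_of_ne hj]) (by simp)] at h1
    rcases hs : w i with _ | _ | _ <;> simp [hs] at h1 ⊢
    all_goals first | rfl | linarith
  refine ⟨e.toLinearEquiv, fun v => ?_⟩
  have := e.map_app v
  rw [← this, QuadraticMap.weightedSumSquares_apply]
  refine Finset.sum_congr rfl fun i _ => ?_
  rw [hw]
  simp [sq]

theorem exists_normal_form_of_quasiHom {f : V → ℝ} (hc : ConvexOn ℝ univ f) (hf : Continuous f)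
    (hg : ∀ p, ∃ T, ∀ w, T ≤ ‖w‖ → f p + ‖w‖ ≤ f (p + w)) (hq : QuasiHomFun f) :
    ∃ (e : V ≃ₗ[ℝ] (Fin (Module.finrank ℝ V) → ℝ)) (φ : V →ₗ[ℝ] ℝ) (c : ℝ),
      ∀ v, f v = ∑ i, e v i ^ 2 + φ v + c := by
  obtain ⟨x₀, hx₀⟩ := secondDiff_eq_of_quasiHom hc hf hg hq
  have hD : ∀ x v, f (x + v) + f (x - v) = 2 * f x + (f v + f (-v) - 2 * f 0) := by
    intro x v
    have h1 := (hx₀ x v).trans (hx₀ 0 v).symm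
    simp only [secondDiff, zero_add, zero_sub] at h1
    linarith
  set Q : V → ℝ := fun v => (f v + f (-v)) / 2 - f 0 with hQ
  set L : V → ℝ := fun v => (f v - f (-v)) / 2 with hL
  obtain ⟨q, hqQ⟩ := exists_quadraticForm_of_parallelogram (Q := Q) (by rw [hQ]; fun_prop) (by
    intro u v
    have e1 := hD u v
    have e2 := hD (-u) v
    simp only [hQ]
    rw [neg_add, neg_sub, show v - u = -u + v by abel, ← sub_eq_add_neg (-u) v]
    linarith)
  have hLmid : ∀ x v, L (x + v) + L (x - v) = 2 * L x := by
    intro x v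
    have e1 := hD x v
    have e2 := hD (-x) v
    simp only [hL]
    rw [neg_add, neg_sub, show v - x = -x + v by abel, ← sub_eq_add_neg (-x) v]
    linarith
  have hL0 : L 0 = 0 := by simp [hL]
  have hLadd : ∀ u v, L (u + v) = L u + L v := by
    intro u v
    have e1 := hLmid ((1 / 2 : ℝ) • (u + v)) ((1 / 2 : ℝ) • (u - v))
    have e2 := hLmid ((1 / 2 : ℝ) • (u + v)) ((1 / 2 : ℝ) • (u + v))
    rw [show (1 / 2 : ℝ) • (u + v) + (1 / 2 : ℝ) • (u - v) = u by module,
      show (1 / 2 : ℝ) • (u + v) - (1 / 2 : ℝ) • (u - v) = v by module] at e1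
    rw [show (1 / 2 : ℝ) • (u + v) + (1 / 2 : ℝ) • (u + v) = u + v by module, sub_self, hL0] at e2
    linarith
  have hpos : ∀ v, v ≠ 0 → 0 < q v := by
    intro v hv
    obtain ⟨R, hR, hb⟩ := secondDiff_bounded hg 0 0
    have hqd : ∀ w, secondDiff f 0 w = 2 * q w := fun w => by
      rw [hqQ]; simp only [secondDiff, hQ, zero_add, zero_sub]; ring
    by_contra! hle
    have hn0 : 0 < ‖v‖ := norm_pos_iff.2 hv
    have := hb ((2 * R / ‖v‖) • v) (by
      rw [hqd, QuadraticMap.map_smul, smul_eq_mul]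
      nlinarith [mul_self_nonneg (2 * R / ‖v‖)])
    rw [norm_smul, Real.norm_of_nonneg (by positivity), div_mul_cancel₀ _ hn0.ne'] at this
    linarith
  obtain ⟨e, he⟩ := exists_sum_sq_of_posDef hpos
  refine ⟨e, ((AddMonoidHom.mk' L hLadd).toRealLinearMap
    (by change Continuous L; rw [hL]; fun_prop) : V →L[ℝ] ℝ), f 0, fun v => ?_⟩
  rw [← he, hqQ]
  change f v = Q v + L v + f 0
  simp only [hQ, hL]
  ring

end SecondDifference

section DomainsOfGraphs

variable {V : Type*} [NormedAddCommGroup V] [InnerProductSpace ℝ V]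

/-- `A` is the linear part of an affine symmetry of the epigraph of `f` over `D`, sending the
base point `k` to `x`. -/
def IsGraphSym (D : Set V) (f : V → ℝ) (A : V ≃L[ℝ] V) (k x : V) (l : ℝ) : Prop :=
  (∀ v, x + A v ∈ D ↔ k + v ∈ D) ∧
    ∃ μ : V →ₗ[ℝ] ℝ, ∀ v, k + v ∈ D → f (x + A v) - f x = l * (f (k + v) - f k) + μ v

theorem IsGraphSym.symAt {f : V → ℝ} {A : V ≃L[ℝ] V} {k x : V} {l : ℝ}
    (h : IsGraphSym univ f A k x l) : SymAt f (A : V →L[ℝ] V) k x l := by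
  obtain ⟨-, μ, hμ⟩ := h
  intro u v
  have h1 := hμ (u + v) (mem_univ _)
  have h2 := hμ (u - v) (mem_univ _)
  have h3 := hμ u (mem_univ _)
  simp only [map_add, map_sub] at h1 h2
  simp only [secondDiff, ContinuousLinearEquiv.coe_coe]
  rw [add_assoc x, add_sub_assoc x, add_assoc k, add_sub_assoc k]
  linarith

theorem exists_step_out {S : Set ℝ} (hS : IsOpen S) (hc : S.OrdConnected) (h0 : (0 : ℝ) ∈ S)
    (h1 : (1 : ℝ) ∉ S) {R : ℝ} (hR : 0 ≤ R) :
    ∃ t d, 0 < d ∧ t ∈ S ∧ t + d ∈ S ∧ t - R * d ∈ S ∧ t + 2 * d ∉ S := by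
  obtain ⟨r, hr, hb⟩ := Metric.isOpen_iff.1 hS 0 h0
  obtain ⟨N, hN⟩ := exists_nat_gt ((R + 1) / r)
  have hN0 : (0 : ℝ) < N := lt_of_le_of_lt (by positivity) hN
  have hNr : (R + 1) * (1 / N) < r := by
    rw [mul_one_div, div_lt_iff₀ hN0]
    rw [div_lt_iff₀ hr] at hN
    linarith
  set d : ℝ := 1 / N with hd
  have hd0 : 0 < d := by positivity
  classical
  have hex : ∃ n : ℕ, (n : ℝ) * d ∉ S := ⟨N, by
    rw [hd, mul_one_div_cancel hN0.ne']; exact h1⟩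
  set n := Nat.find hex with hn
  have hspec : (n : ℝ) * d ∉ S := Nat.find_spec hex
  have hmin : ∀ m < n, (m : ℝ) * d ∈ S := fun m hm => not_not.1 (Nat.find_min hex hm)
  have hball : ∀ t : ℝ, |t| < r → t ∈ S := fun t ht => hb (by simpa using ht)
  have hn2 : 2 ≤ n := by
    by_contra! hlt
    refine hspec ?_
    interval_cases n
    · simpa using h0
    · refine hball _ ?_
      rw [Nat.cast_one, one_mul, abs_of_pos hd0]
      nlinarith
  have hc1 : ((n - 2 : ℕ) : ℝ) = n - 2 := by push_cast [hn2]; ring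
  have hc2 : ((n - 1 : ℕ) : ℝ) = n - 1 := by
    rw [Nat.cast_sub (by omega)]; simp
  have ht := hmin (n - 2) (by omega)
  have ht1 := hmin (n - 1) (by omega)
  rw [hc1] at ht
  rw [hc2] at ht1
  have hn2' : (2 : ℝ) ≤ n := by exact_mod_cast hn2
  refine ⟨(n - 2) * d, d, hd0, ht, ?_, ?_, ?_⟩
  · convert ht1 using 1; ring
  · refine hc.out (hball (-(R * d)) ?_) ht ⟨?_, ?_⟩
    · rw [abs_neg, abs_of_nonneg (by positivity)]; nlinarith
    · nlinarith [mul_nonneg (sub_nonneg.2 hn2') hd0.le]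
    · nlinarith
  · convert hspec using 2; ring

theorem eq_univ_of_graphSym {D : Set V} {f : V → ℝ} (hD : IsOpen D) (hc : ConvexOn ℝ D f)
    (hne : D.Nonempty) (hf : ContinuousOn f D) [FiniteDimensional ℝ V]
    {K : Set V} (hK : IsCompact K) (hKD : K ⊆ D) {a b : ℝ}
    (hg : ∀ M, ∃ T, ∀ k ∈ K, ∀ w, T ≤ ‖w‖ → k + w ∈ D → f k + M * ‖w‖ < f (k + w))
    (hs : ∀ x ∈ D, ∀ s, 0 < s → ∃ (A : V ≃L[ℝ] V) (k : V) (l : ℝ), k ∈ K ∧ 0 < l ∧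
      l * a ≤ s ∧ s ≤ l * b ∧ IsGraphSym D f A k x l) : D = univ := by
  by_contra hDu
  obtain ⟨z, hz⟩ := (ne_univ_iff_exists_notMem D).1 hDu
  obtain ⟨x₀, hx₀⟩ := hne
  obtain ⟨r, hr, hrD⟩ := hK.exists_cthickening_subset_open hD hKD
  obtain ⟨B, hB⟩ := (hK.cthickening (r := r)).exists_bound_of_continuousOn (hf.mono hrD)
  have hKt : ∀ k ∈ K, ∀ w, ‖w‖ ≤ r → k + w ∈ Metric.cthickening r K := fun k hk w hw =>
    Metric.mem_cthickening_of_dist_le _ k _ _ hk (by simpa [dist_eq_norm] using hw)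
  have hsub : ∀ k ∈ K, ∀ w, w ≠ 0 → k + w ∈ D → f k - 2 * B / r * ‖w‖ ≤ f (k + w) := by
    intro k hk w hw hkw
    have hw0 : 0 < ‖w‖ := norm_pos_iff.2 hw
    set τ := r / ‖w‖ with hτ
    have hτ0 : 0 < τ := by positivity
    have hp : k + (-τ) • w ∈ Metric.cthickening r K := hKt k hk _ (by
      rw [norm_smul, norm_neg, Real.norm_of_nonneg hτ0.le, hτ, div_mul_cancel₀ _ hw0.ne'])
    have hk' : k ∈ Metric.cthickening r K := by simpa using hKt k hk 0 (by simpa using hr.le)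
    have h1 := hc.2 (hrD hp) hkw (by positivity : 0 ≤ 1 / (1 + τ))
      (by positivity : 0 ≤ τ / (1 + τ)) (by field_simp)
    rw [show (1 / (1 + τ)) • (k + (-τ) • w) + (τ / (1 + τ)) • (k + w) = k by
      match_scalars <;> field_simp; ring, smul_eq_mul, smul_eq_mul] at h1
    have h2 := abs_le.1 (hB _ hp)
    have h3 := abs_le.1 (hB _ hk')
    have h4 : f k * (1 + τ) ≤ f (k + (-τ) • w) + τ * f (k + w) := by
      have := mul_le_mul_of_nonneg_right h1 (by positivity : (0 : ℝ) ≤ 1 + τ)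
      refine this.trans (le_of_eq ?_)
      field_simp
    have h5 : -(2 * B) ≤ τ * (f (k + w) - f k) := by nlinarith
    have h6 : τ * (2 * B / r * ‖w‖) = 2 * B := by rw [hτ]; field_simp
    have h7 : τ * (f k - 2 * B / r * ‖w‖) ≤ τ * f (k + w) := by nlinarith
    exact le_of_mul_le_mul_left h7 hτ0
  set L := 2 * B / r with hL
  obtain ⟨T, hT⟩ := hg (L + 1)
  set R := 2 * (|T| + |b| + 1) / r with hR
  have hR0 : 0 < R := by positivity
  set S : Set ℝ := {t | x₀ + t • (z - x₀) ∈ D} with hS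
  have hSo : IsOpen S := hD.preimage (f := fun t : ℝ => x₀ + t • (z - x₀)) (by fun_prop)
  have hSc : S.OrdConnected := by
    refine Convex.ordConnected ?_
    intro s hs t ht α β hα hβ hαβ
    have := hc.1 hs ht hα hβ hαβ
    simp only [hS, mem_ofPred_eq, smul_eq_mul]
    convert this using 1
    rw [← eq_sub_iff_add_eq'] at hαβ
    subst hαβ
    module
  obtain ⟨t, d, hd, ht, ht1, htR, ht2⟩ := exists_step_out hSo hSc (by simpa [hS] using hx₀)
    (by simpa [hS] using hz) hR0.le
  set x := x₀ + t • (z - x₀) with hx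
  set w := d • (z - x₀) with hw
  have hx1 : x + w ∈ D := by
    have : x₀ + (t + d) • (z - x₀) ∈ D := ht1
    convert this using 1; rw [hx, hw]; module
  have hxR : x + (-R) • w ∈ D := by
    have : x₀ + (t - R * d) • (z - x₀) ∈ D := htR
    convert this using 1; rw [hx, hw]; module
  have hx2 : x + (2 : ℝ) • w ∉ D := by
    have : x₀ + (t + 2 * d) • (z - x₀) ∉ D := ht2
    convert this using 2; rw [hx, hw]; module
  clear_value w
  obtain ⟨A, k, l, hk, hl, -, hlb, hA, μ, hμ⟩ := hs x ht
    (max 1 (f (x + (-R) • w) - f x + R * (f (x + w) - f x))) (by positivity)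
  obtain ⟨u, rfl⟩ : ∃ u, A u = w := A.surjective w
  rw [← map_smul] at hx2 hxR hlb
  rw [hA] at hx1 hx2 hxR
  have e1 := hμ _ hx1
  have e2 := hμ _ hxR
  rw [μ.map_smul, smul_eq_mul] at e2
  have hle := (le_max_right _ _).trans hlb
  rw [e1, e2] at hle
  have hle' : f (k + (-R) • u) - f k + R * (f (k + u) - f k) ≤ b := by
    refine le_of_mul_le_mul_left ?_ hl
    linarith
  have hu : r < 2 * ‖u‖ := by
    by_contra! hu
    exact hx2 (hrD (hKt k hk _ (by rw [norm_smul]; simpa using hu)))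
  have hu0 : u ≠ 0 := by rintro rfl; simp at hu; linarith
  have h1 := hsub k hk u hu0 hx1
  have hn : ‖(-R) • u‖ = R * ‖u‖ := by rw [norm_smul, norm_neg, Real.norm_of_nonneg hR0.le]
  have hRr : |T| + |b| + 1 ≤ R * ‖u‖ := by
    have : R * r = 2 * (|T| + |b| + 1) := by rw [hR]; field_simp
    nlinarith
  have h2 := hT k hk ((-R) • u) (by rw [hn]; linarith [le_abs_self T, abs_nonneg b]) hxR
  rw [hn] at h2
  have h3 : R * (-(L * ‖u‖)) ≤ R * (f (k + u) - f k) :=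
    mul_le_mul_of_nonneg_left (by linarith) hR0.le
  linarith [le_abs_self b, abs_nonneg T]

theorem add_smul_mem_of_ray_mem_closure {E : Type*} [AddCommGroup E] [Module ℝ E]
    [TopologicalSpace E] [IsTopologicalAddGroup E] [ContinuousSMul ℝ E] {Ω : Set E}
    (ho : IsOpen Ω) (hc : Convex ℝ Ω) {y u : E} (hy : ∀ t : ℝ, 0 ≤ t → y + t • u ∈ closure Ω)
    {x : E} (hx : x ∈ Ω) {t : ℝ} (ht : 0 ≤ t) : x + t • u ∈ Ω := by
  have hcont : Continuous fun η : ℝ => x + η • (x - y) := by fun_prop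
  have hmem : ∀ᶠ η in 𝓝 (0 : ℝ), x + η • (x - y) ∈ Ω :=
    hcont.continuousAt.eventually (ho.mem_nhds (by simpa using hx))
  obtain ⟨η, hη, hη0⟩ := ((hmem.filter_mono nhdsWithin_le_nhds).and
    (self_mem_nhdsWithin (s := Ioi (0 : ℝ)))).exists
  have hη0 : 0 < η := hη0
  rw [← ho.interior_eq] at hη
  have h1 := hc.combo_interior_closure_mem_interior hη
    (hy (t * (1 + η) / η) (by positivity)) (a := 1 / (1 + η)) (b := η / (1 + η)) (by positivity)
    (by positivity) (by field_simp)
  rw [ho.interior_eq] at h1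
  convert h1 using 1
  match_scalars <;> field_simp
  ring

theorem exists_epigraph {Ω : Set (V × ℝ)} (ho : IsOpen Ω) (hc : Convex ℝ Ω)
    (hAC : ∀ u : V × ℝ, (∀ x ∈ Ω, ∀ t : ℝ, 0 ≤ t → x + t • u ∈ Ω) ↔ u.1 = 0 ∧ 0 ≤ u.2) :
    ∃ f : V → ℝ, ConvexOn ℝ (Prod.fst '' Ω) f ∧
      ∀ p : V × ℝ, p ∈ Ω ↔ p.1 ∈ Prod.fst '' Ω ∧ f p.1 < p.2 := by
  have hup : ∀ x s t, (x, s) ∈ Ω → s ≤ t → (x, t) ∈ Ω := by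
    intro x s t hs hst
    have := (hAC (0, 1)).2 ⟨rfl, zero_le_one⟩ _ hs (t - s) (sub_nonneg.2 hst)
    simpa using this
  have hbdd : ∀ x, BddBelow {t | (x, t) ∈ Ω} := by
    intro x
    by_contra hb
    rw [not_bddBelow_iff] at hb
    have hall : ∀ t, (x, t) ∈ Ω := fun t => by
      obtain ⟨s, hs, hst⟩ := hb t
      exact hup _ _ _ hs hst.le
    have := ((hAC (0, -1)).1 fun y hy t ht =>
      add_smul_mem_of_ray_mem_closure ho hc (y := (x, 0)) (fun t _ => subset_closure (by
        simpa using hall (-t))) hy ht).2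
    norm_num at this
  have hiff : ∀ p : V × ℝ, p ∈ Ω ↔ p.1 ∈ Prod.fst '' Ω ∧ sInf {t | (p.1, t) ∈ Ω} < p.2 := by
    rintro ⟨x, t⟩
    constructor
    · intro h
      refine ⟨⟨_, h, rfl⟩, ?_⟩
      have hcont : Continuous fun s : ℝ => (x, s) := by fun_prop
      have hmem : ∀ᶠ s in 𝓝 t, (x, s) ∈ Ω := hcont.continuousAt.eventually (ho.mem_nhds h)
      obtain ⟨s, hs, hst⟩ := ((hmem.filter_mono nhdsWithin_le_nhds).and
        (self_mem_nhdsWithin (s := Iio t))).exists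
      exact (csInf_le (hbdd x) hs).trans_lt hst
    · rintro ⟨⟨⟨y, s⟩, hy, rfl⟩, hlt⟩
      obtain ⟨s', hs', hlt'⟩ := exists_lt_of_csInf_lt ⟨s, hy⟩ hlt
      exact hup _ _ _ hs' hlt'.le
  refine ⟨fun x => sInf {t | (x, t) ∈ Ω}, ⟨hc.linear_image (LinearMap.fst ℝ V ℝ), ?_⟩, hiff⟩
  intro x hx y hy α β hα hβ hαβ
  refine le_of_forall_pos_le_add fun ε hε => ?_
  have h1 := (hiff (x, sInf {t | (x, t) ∈ Ω} + ε)).2 ⟨hx, by simpa using hε⟩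
  have h2 := (hiff (y, sInf {t | (y, t) ∈ Ω} + ε)).2 ⟨hy, by simpa using hε⟩
  have h3 := ((hiff _).1 (hc h1 h2 hα hβ hαβ)).2.le
  simp only [Prod.smul_mk, Prod.mk_add_mk, smul_eq_mul] at h3 ⊢
  refine h3.trans (le_of_eq ?_)
  linear_combination ε * hαβ

theorem superlinear_growth {Ω : Set (V × ℝ)} {D : Set V} {f : V → ℝ} (ho : IsOpen Ω)
    (hc : Convex ℝ Ω) [FiniteDimensional ℝ V]
    (hAC : ∀ u : V × ℝ, (∀ x ∈ Ω, ∀ t : ℝ, 0 ≤ t → x + t • u ∈ Ω) ↔ u.1 = 0 ∧ 0 ≤ u.2)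
    (hΩ : ∀ p : V × ℝ, p ∈ Ω ↔ p.1 ∈ D ∧ f p.1 < p.2) (hf : ConvexOn ℝ D f)
    (hfc : ContinuousOn f D) {K : Set V} (hK : IsCompact K) (hKD : K ⊆ D) (M : ℝ) :
    ∃ T, ∀ k ∈ K, ∀ w, T ≤ ‖w‖ → k + w ∈ D → f k + M * ‖w‖ < f (k + w) := by
  by_contra! h
  choose k hk w hw hkw hle using fun j : ℕ => h (j + 1)
  have hw0 : ∀ j, 0 < ‖w j‖ := fun j => lt_of_lt_of_le (by positivity) (hw j)
  set e : ℕ → V := fun j => ‖w j‖⁻¹ • w j with he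
  have hes : ∀ j, e j ∈ Metric.sphere (0 : V) 1 := fun j => by
    simp [he, norm_smul, (hw0 j).ne']
  obtain ⟨⟨k₀, e₀⟩, hke, φ, hφ, hlim⟩ := (hK.prod (isCompact_sphere (0 : V) 1)).tendsto_subseq
    (x := fun j => (k j, e j)) fun j => ⟨hk j, hes j⟩
  have hk₀ : k₀ ∈ K := hke.1
  have he₀ : e₀ ≠ 0 := by
    have : ‖e₀‖ = 1 := by simpa using hke.2
    intro h0; rw [h0] at this; simp at this
  have hlk : Tendsto (fun j => k (φ j)) atTop (𝓝 k₀) := (continuous_fst.tendsto _).comp hlim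
  have hle' : Tendsto (fun j => e (φ j)) atTop (𝓝 e₀) := (continuous_snd.tendsto _).comp hlim
  have hlf : Tendsto (fun j => f (k (φ j))) atTop (𝓝 (f k₀)) :=
    (hfc k₀ (hKD hk₀)).tendsto.comp
      (tendsto_nhdsWithin_iff.2 ⟨hlk, Eventually.of_forall fun j => hKD (hk _)⟩)
  have hray : ∀ t : ℝ, 0 ≤ t → (k₀, f k₀ + 1) + t • (e₀, M) ∈ closure Ω := by
    intro t ht
    have hl : Tendsto (fun j => (k (φ j) + t • e (φ j), f (k (φ j)) + 1 + t * M)) atTop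
        (𝓝 (k₀ + t • e₀, f k₀ + 1 + t * M)) :=
      (hlk.add (hle'.const_smul t)).prodMk_nhds ((hlf.add_const 1).add_const _)
    refine mem_closure_of_tendsto hl ?_
    obtain ⟨N, hN⟩ := exists_nat_gt t
    filter_upwards [eventually_ge_atTop N] with j hj
    have hbig : t ≤ ‖w (φ j)‖ := by
      have h1 : (N : ℝ) ≤ φ j := by exact_mod_cast hj.trans (hφ.id_le j)
      linarith [hw (φ j)]
    have hn := hw0 (φ j)
    set n := ‖w (φ j)‖ with hnd
    have h1 : k (φ j) + t • e (φ j) = (1 - t / n) • k (φ j) + (t / n) • (k (φ j) + w (φ j)) := by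
      simp only [he]
      rw [← hnd]
      match_scalars <;> field_simp
      ring
    have hα : 0 ≤ 1 - t / n := sub_nonneg.2 ((div_le_one hn).2 hbig)
    have hβ : 0 ≤ t / n := by positivity
    rw [hΩ]
    simp only
    rw [h1]
    refine ⟨hf.1 (hKD (hk _)) (hkw _) hα hβ (by ring), ?_⟩
    refine (hf.2 (hKD (hk _)) (hkw _) hα hβ (by ring)).trans_lt ?_
    simp only [smul_eq_mul]
    have h2 := mul_le_mul_of_nonneg_left (hle (φ j)) hβ
    rw [← hnd] at h2
    have h3 : t / n * (f (k (φ j)) + M * n) = t / n * f (k (φ j)) + t * M := by field_simp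
    linarith
  exact he₀ ((hAC (e₀, M)).1 fun x hx t ht =>
    add_smul_mem_of_ray_mem_closure ho hc hray hx ht).1

theorem exists_graphSym {Ω : Set (V × ℝ)} {D : Set V} {f : V → ℝ} [FiniteDimensional ℝ V]
    (hAC : ∀ u : V × ℝ, (∀ x ∈ Ω, ∀ t : ℝ, 0 ≤ t → x + t • u ∈ Ω) ↔ u.1 = 0 ∧ 0 ≤ u.2)
    (hΩ : ∀ p : V × ℝ, p ∈ Ω ↔ p.1 ∈ D ∧ f p.1 < p.2) {p q : V × ℝ} (hq : q ∈ Ω)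
    (L : (V × ℝ) ≃ₗ[ℝ] (V × ℝ)) (hL : ∀ u, p + L u ∈ Ω ↔ q + u ∈ Ω) :
    ∃ (A : V ≃L[ℝ] V) (l : ℝ), 0 < l ∧ p.2 - f p.1 = l * (q.2 - f q.1) ∧
      IsGraphSym D f A q.1 p.1 l := by
  obtain ⟨hv1, hv2⟩ := (hAC (L (0, 1))).1 fun x hx t ht => by
    obtain ⟨u, hu⟩ := L.surjective (x - p)
    have h1 : q + u ∈ Ω := by rw [← hL, hu]; simpa using hx
    have h2 := (hL _).2 ((add_assoc q u _) ▸ (hAC (0, 1)).2 ⟨rfl, zero_le_one⟩ _ h1 t ht)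
    rw [map_add, map_smul, hu] at h2
    convert h2 using 1
    abel
  set l := (L (0, 1)).2 with hl
  have hL1 : L (0, 1) = (0, l) := Prod.ext hv1 rfl
  have hl0 : 0 < l := by
    refine lt_of_le_of_ne hv2 fun h => ?_
    rw [← h] at hL1
    have : ((0 : V), (1 : ℝ)) = 0 := L.injective (by rw [hL1, map_zero]; rfl)
    simpa using congrArg Prod.snd this
  set A₀ : V →ₗ[ℝ] V := LinearMap.fst ℝ V ℝ ∘ₗ (L : V × ℝ →ₗ[ℝ] V × ℝ) ∘ₗ LinearMap.inl ℝ V ℝ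
    with hA₀
  set μ : V →ₗ[ℝ] ℝ := LinearMap.snd ℝ V ℝ ∘ₗ (L : V × ℝ →ₗ[ℝ] V × ℝ) ∘ₗ LinearMap.inl ℝ V ℝ
    with hμ
  have hLvt : ∀ v t, L (v, t) = (A₀ v, μ v + t * l) := by
    intro v t
    have h1 : ((v, t) : V × ℝ) = (v, 0) + t • (0, 1) := by simp
    rw [h1, map_add, map_smul, hL1]
    ext <;> simp [hA₀, hμ]
  have hinj : Function.Injective A₀ := by
    refine (injective_iff_map_eq_zero A₀).2 fun v hv => ?_
    have h1 := hLvt v (-(μ v / l))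
    rw [hv, neg_mul, div_mul_cancel₀ _ hl0.ne', add_neg_cancel] at h1
    have : (v, -(μ v / l)) = (0 : V × ℝ) := L.injective (by rw [h1, map_zero]; rfl)
    exact congrArg Prod.fst this
  have hiff : ∀ v t, (p.1 + A₀ v ∈ D ∧ f (p.1 + A₀ v) < p.2 + (μ v + t * l)) ↔
      (q.1 + v ∈ D ∧ f (q.1 + v) < q.2 + t) := by
    intro v t
    have := hL (v, t)
    rw [hLvt, hΩ, hΩ] at this
    exact this
  have hD : ∀ v, p.1 + A₀ v ∈ D ↔ q.1 + v ∈ D := by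
    intro v
    constructor
    · intro h
      refine ((hiff v ((|f (p.1 + A₀ v) - p.2 - μ v| + 1) / l)).1 ⟨h, ?_⟩).1
      rw [div_mul_cancel₀ _ hl0.ne']
      linarith [le_abs_self (f (p.1 + A₀ v) - p.2 - μ v)]
    · intro h
      exact ((hiff v (f (q.1 + v) - q.2 + 1)).2 ⟨h, by linarith⟩).1
  have heq : ∀ v, q.1 + v ∈ D → f (p.1 + A₀ v) - p.2 - μ v = l * (f (q.1 + v) - q.2) := by
    intro v hv
    have hv' := (hD v).2 hv
    have key : ∀ t, f (p.1 + A₀ v) - p.2 - μ v < t * l ↔ f (q.1 + v) - q.2 < t := by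
      intro t
      have := hiff v t
      simp only [hv, hv', true_and] at this
      rw [show f (q.1 + v) - q.2 < t ↔ f (q.1 + v) < q.2 + t from sub_lt_iff_lt_add', ← this]
      constructor <;> intro h <;> linarith
    refine le_antisymm (le_of_forall_pos_lt_add fun ε hε => ?_) ?_
    · have := (key (f (q.1 + v) - q.2 + ε / l)).2 (by linarith [div_pos hε hl0])
      rw [add_mul, div_mul_cancel₀ _ hl0.ne'] at this
      linarith
    · refine le_of_forall_pos_lt_add fun ε hε => ?_
      have := (key ((f (p.1 + A₀ v) - p.2 - μ v + ε) / l)).1 (by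
        rw [div_mul_cancel₀ _ hl0.ne']; linarith)
      rwa [lt_div_iff₀ hl0, mul_comm] at this
  have hq' := (hΩ q).1 hq
  have h0 := heq 0 (by simpa using hq'.1)
  simp only [map_zero, add_zero, sub_zero] at h0
  refine ⟨(LinearEquiv.ofInjectiveEndo A₀ hinj).toContinuousLinearEquiv, l, hl0, by linarith,
    hD, μ, fun v hv => ?_⟩
  have := heq v hv
  change f (p.1 + A₀ v) - f p.1 = _
  linarith

theorem exists_paraboloid_normal_form {Ω : Set (V × ℝ)} [FiniteDimensional ℝ V] (ho : IsOpen Ω)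
    (hc : Convex ℝ Ω) (hne : Ω.Nonempty)
    (hAC : ∀ u : V × ℝ, (∀ x ∈ Ω, ∀ t : ℝ, 0 ≤ t → x + t • u ∈ Ω) ↔ u.1 = 0 ∧ 0 ≤ u.2)
    {K : Set (V × ℝ)} (hK : IsCompact K) (hKΩ : K ⊆ Ω)
    (hq : ∀ p ∈ Ω, ∃ q ∈ K, ∃ L : (V × ℝ) ≃ₗ[ℝ] (V × ℝ), ∀ u, p + L u ∈ Ω ↔ q + u ∈ Ω) :
    ∃ (e : V ≃ₗ[ℝ] (Fin (Module.finrank ℝ V) → ℝ)) (φ : V →ₗ[ℝ] ℝ) (c : ℝ),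
      ∀ p : V × ℝ, p ∈ Ω ↔ ∑ i, e p.1 i ^ 2 + φ p.1 + c < p.2 := by
  obtain ⟨f, hf, hΩ⟩ := exists_epigraph ho hc hAC
  set D := Prod.fst '' Ω with hD
  have hDo : IsOpen D := isOpenMap_fst _ ho
  have hfc : ContinuousOn f D := hf.continuousOn hDo
  obtain ⟨p₀, hp₀⟩ := hne
  have hKne : K.Nonempty := let ⟨q, hq, _⟩ := hq p₀ hp₀; ⟨q, hq⟩
  have hcont : ContinuousOn (fun q : V × ℝ => q.2 - f q.1) K :=
    continuous_snd.continuousOn.sub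
      (hfc.comp continuous_fst.continuousOn fun q hq => ⟨q, hKΩ hq, rfl⟩)
  obtain ⟨q₁, hq₁, hmin⟩ := hK.exists_isMinOn hKne hcont
  obtain ⟨q₂, hq₂, hmax⟩ := hK.exists_isMaxOn hKne hcont
  set a := q₁.2 - f q₁.1 with ha
  set b := q₂.2 - f q₂.1 with hb
  have ha0 : 0 < a := sub_pos.2 ((hΩ _).1 (hKΩ hq₁)).2
  have hab : a ≤ b := hmin hq₂
  have hs : ∀ x ∈ D, ∀ s, 0 < s → ∃ (A : V ≃L[ℝ] V) (k : V) (l : ℝ), k ∈ Prod.fst '' K ∧ 0 < l ∧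
      l * a ≤ s ∧ s ≤ l * b ∧ IsGraphSym D f A k x l := by
    intro x hx s hs
    obtain ⟨q, hqK, L, hL⟩ := hq (x, f x + s) ((hΩ _).2 ⟨hx, by simpa using hs⟩)
    obtain ⟨A, l, hl, hls, hsym⟩ := exists_graphSym hAC hΩ (hKΩ hqK) L hL
    rw [add_sub_cancel_left] at hls
    refine ⟨A, q.1, l, ⟨q, hqK, rfl⟩, hl, ?_, ?_, hsym⟩
    · rw [hls]; exact mul_le_mul_of_nonneg_left (hmin hqK) hl.le
    · rw [hls]; exact mul_le_mul_of_nonneg_left (hmax hqK) hl.le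
  have hK1 : IsCompact (Prod.fst '' K) := hK.image continuous_fst
  have hDu : D = univ := eq_univ_of_graphSym hDo hf ⟨_, p₀, hp₀, rfl⟩ hfc hK1 (image_mono hKΩ)
    (superlinear_growth ho hc hAC hΩ hf hfc hK1 (image_mono hKΩ)) hs
  rw [hDu] at hf hfc hs hΩ
  obtain ⟨e, φ, c, he⟩ := exists_normal_form_of_quasiHom hf (continuousOn_univ.1 hfc) (fun p => by
      obtain ⟨T, hT⟩ := superlinear_growth ho hc hAC hΩ hf hfc (isCompact_singleton (x := p))
        (subset_univ _) 1
      exact ⟨T, fun w hw => by simpa using (hT p rfl w hw (mem_univ _)).le⟩)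
    ⟨_, hK1, a, b, ha0, ha0.trans_le hab, fun x s hs' => by
      obtain ⟨A, k, l, hk, hl, h1, h2, h3⟩ := hs x (mem_univ _) s hs'
      exact ⟨A, k, l, hk, hl, h1, h2, h3.symAt⟩⟩
  exact ⟨e, φ, c, fun p => by rw [hΩ, he]; simp⟩

end DomainsOfGraphs

theorem exists_linearEquiv_of_mem_autSet {n : ℕ} {Ω : Set (Fin n → ℝ)} {g : GL (Fin (n + 1)) ℝ}
    (hg : g ∈ AutSet n Ω) (k : Fin n → ℝ) : ∃ L : (Fin n → ℝ) ≃ₗ[ℝ] (Fin n → ℝ),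
      ∀ u, affAct n g k + L u ∈ Ω ↔ k + u ∈ Ω := by
  obtain ⟨⟨hrow, -⟩, hΩ⟩ := hg
  set M : Matrix (Fin n) (Fin n) ℝ := Matrix.of fun i j => g.val i.castSucc j.castSucc with hM
  have hadd : ∀ x u, affAct n g (x + u) = affAct n g x + M.mulVecLin u := by
    intro x u
    ext i
    simp only [affAct, Pi.add_apply, Matrix.mulVecLin_apply, Matrix.mulVec, dotProduct, hM,
      Matrix.of_apply, mul_add, Finset.sum_add_distrib]
    ring
  have hinj : Function.Injective M.mulVecLin := by
    refine (injective_iff_map_eq_zero M.mulVecLin).2 fun v hv => ?_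
    have h0 : g.val *ᵥ (Fin.snoc v 0 : Fin (n + 1) → ℝ) = 0 := by
      ext i
      rw [Matrix.mulVec, dotProduct, Fin.sum_univ_castSucc]
      simp only [Fin.snoc_castSucc, Fin.snoc_last, mul_zero, add_zero, Pi.zero_apply]
      refine Fin.lastCases ?_ (fun i => ?_) i
      · simp [hrow]
      · exact congrFun hv i
    have h1 : (Fin.snoc v 0 : Fin (n + 1) → ℝ) = 0 := by
      have := congrArg (g.inv *ᵥ ·) h0
      simpa only [Matrix.mulVec_mulVec, g.inv_val, Matrix.one_mulVec, Matrix.mulVec_zero] using this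
    ext i
    have := congrFun h1 i.castSucc
    simpa using this
  have hact : Function.Injective (affAct n g) := by
    intro x y hxy
    have := hadd x (y - x)
    rw [add_sub_cancel, hxy, left_eq_add] at this
    exact (sub_eq_zero.1 (hinj (this.trans (map_zero _).symm))).symm
  refine ⟨LinearEquiv.ofInjectiveEndo _ hinj, fun u => ?_⟩
  change affAct n g k + M.mulVecLin u ∈ Ω ↔ _
  rw [← hadd]
  nth_rewrite 1 [← hΩ]
  exact hact.mem_set_image

theorem asympCone_eq_ray {n : ℕ} {Ω : Set (Fin n → ℝ)} (hne : Ω.Nonempty) (hl : HasNoLine n Ω)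
    (hAC : Module.finrank ℝ (Submodule.span ℝ (asympCone n Ω)) = 1) :
    ∃ u : Fin n → ℝ, u ≠ 0 ∧ ∀ w, w ∈ asympCone n Ω ↔ ∃ c : ℝ, 0 ≤ c ∧ w = c • u := by
  have hsmul : ∀ w ∈ asympCone n Ω, ∀ c : ℝ, 0 ≤ c → c • w ∈ asympCone n Ω := by
    intro w hw c hc x hx t ht
    rw [smul_smul]
    exact hw x hx _ (by positivity)
  obtain ⟨u, hu, hu0⟩ : ∃ u ∈ asympCone n Ω, u ≠ 0 := by
    by_contra! h
    rw [Submodule.span_eq_bot.2 h, finrank_bot] at hAC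
    exact zero_ne_one hAC
  refine ⟨u, hu0, fun w => ⟨fun hw => ?_, ?_⟩⟩
  · obtain ⟨c, hc⟩ := (finrank_eq_one_iff_of_nonzero'
      (⟨u, Submodule.subset_span hu⟩ : Submodule.span ℝ (asympCone n Ω))
      (by simpa [Subtype.ext_iff] using hu0)).1 hAC ⟨w, Submodule.subset_span hw⟩
    have hc' : c • u = w := congrArg Subtype.val hc
    refine ⟨c, ?_, hc'.symm⟩
    by_contra! hneg
    obtain ⟨x, hx⟩ := hne
    refine hl ⟨x, hx, u, hu0, fun t => ?_⟩
    rcases le_total 0 t with ht | ht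
    · exact hu x hx t ht
    · have := hw x hx (t / c) (div_nonneg_of_nonpos ht hneg.le)
      rwa [← hc', smul_smul, div_mul_cancel₀ _ hneg.ne] at this
  · rintro ⟨c, hc, rfl⟩
    exact hsmul u hu c hc

theorem exists_linearEquiv_prod {E V : Type*} [AddCommGroup E] [Module ℝ E] [FiniteDimensional ℝ E]
    [NormedAddCommGroup V] [NormedSpace ℝ V] [FiniteDimensional ℝ V]
    (h : Module.finrank ℝ E = Module.finrank ℝ V + 1) {u : E} (hu : u ≠ 0) :
    ∃ e : E ≃ₗ[ℝ] V × ℝ, e u = (0, 1) := by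
  have e₀ : E ≃ₗ[ℝ] V × ℝ := LinearEquiv.ofFinrankEq _ _ (by simpa using h)
  obtain ⟨B, hB⟩ := SeparatingDual.exists_continuousLinearEquiv_apply_eq (R := ℝ)
    (x := e₀ u) (y := ((0 : V), (1 : ℝ))) (by simpa using hu) (by simp)
  exact ⟨e₀.trans B.toLinearEquiv, hB⟩

theorem affinelyEquivalent_paraboloid {Ω : Set (Fin 4 → ℝ)} {V : Type*} [AddCommGroup V]
    [Module ℝ V] (e₁ : (Fin 4 → ℝ) ≃ₗ[ℝ] V × ℝ) (e : V ≃ₗ[ℝ] (Fin 3 → ℝ)) (φ : V →ₗ[ℝ] ℝ) (c : ℝ)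
    (h : ∀ x, x ∈ Ω ↔ ∑ i, e (e₁ x).1 i ^ 2 + φ (e₁ x).1 + c < (e₁ x).2) :
    AffinelyEquivalent 4 Ω {x : Fin 4 → ℝ | x 0 ^ 2 + x 1 ^ 2 + x 2 ^ 2 < x 3} := by
  let F : (Fin 4 → ℝ) →ₗ[ℝ] (Fin 4 → ℝ) :=
    { toFun := fun x => ![e (e₁ x).1 0, e (e₁ x).1 1, e (e₁ x).1 2, (e₁ x).2 - φ (e₁ x).1]
      map_add' := fun x y => by
        ext i
        fin_cases i <;> simp
        ring
      map_smul' := fun r x => by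
        ext i
        fin_cases i <;> simp
        ring }
  have hF : ∀ x, F x = ![e (e₁ x).1 0, e (e₁ x).1 1, e (e₁ x).1 2, (e₁ x).2 - φ (e₁ x).1] :=
    fun _ => rfl
  have hinj : Function.Injective F := by
    refine (injective_iff_map_eq_zero F).2 fun x hx => ?_
    rw [hF] at hx
    have h1 : (e₁ x).1 = 0 := by
      refine (map_eq_zero_iff e e.injective).1 (funext fun i => ?_)
      fin_cases i
      · exact congrFun hx 0
      · exact congrFun hx 1
      · exact congrFun hx 2
    have h2 : (e₁ x).2 - φ (e₁ x).1 = 0 := congrFun hx 3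
    rw [h1, map_zero, sub_zero] at h2
    exact (map_eq_zero_iff e₁ e₁.injective).1 (Prod.ext h1 h2)
  set A : (Fin 4 → ℝ) ≃ᵃ[ℝ] (Fin 4 → ℝ) :=
    (LinearEquiv.ofInjectiveEndo F hinj).toAffineEquiv.trans
      (AffineEquiv.constVAdd ℝ (Fin 4 → ℝ) ![0, 0, 0, -c]) with hA
  have hAx : ∀ x, A x = ![0, 0, 0, -c] + F x := fun _ => rfl
  refine ⟨A, ?_⟩
  have hpre : Ω = A ⁻¹' {x : Fin 4 → ℝ | x 0 ^ 2 + x 1 ^ 2 + x 2 ^ 2 < x 3} := by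
    ext x
    rw [h, mem_preimage, mem_ofPred_eq, hAx, hF, Fin.sum_univ_three]
    simp
    constructor <;> intro h <;> linarith
  rw [hpre]
  exact image_preimage_eq _ A.surjective

/-- a properly convex quasi-homogeneous affine domain in ℝ⁴ with
1-dimensional asymptotic cone is affinely equivalent to the 4-dimensional paraboloid. -/
theorem dim4_asympCone_one (Ω : Set (Fin 4 → ℝ))
    (h1 : IsProperlyConvexDomain 4 Ω) (h2 : IsQuasiHomogeneous 4 Ω)
    (hAC : Module.finrank ℝ (Submodule.span ℝ (asympCone 4 Ω)) = 1) :
    AffinelyEquivalent 4 Ω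
      {x : Fin 4 → ℝ | x 0 ^ 2 + x 1 ^ 2 + x 2 ^ 2 < x 3} := by
  obtain ⟨⟨hne, ho, hc⟩, hl⟩ := h1
  obtain ⟨K, hK, hKΩ, hcov⟩ := h2
  obtain ⟨u, hu0, hu⟩ := asympCone_eq_ray hne hl hAC
  obtain ⟨e₁, he₁⟩ := exists_linearEquiv_prod (V := EuclideanSpace ℝ (Fin 3)) (by simp) hu0
  have hmem : ∀ p, p ∈ e₁.symm ⁻¹' Ω ↔ e₁.symm p ∈ Ω := fun _ => Iff.rfl
  have hcont : Continuous e₁.symm := e₁.symm.toLinearMap.continuous_of_finiteDimensional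
  have hcont' : Continuous e₁ := e₁.toLinearMap.continuous_of_finiteDimensional
  have hform := exists_paraboloid_normal_form (Ω := e₁.symm ⁻¹' Ω) (ho.preimage hcont)
    (hc.linear_preimage e₁.symm.toLinearMap) (hne.preimage e₁.symm.surjective) (fun w => by
      have h1 : (∀ x ∈ e₁.symm ⁻¹' Ω, ∀ t : ℝ, 0 ≤ t → x + t • w ∈ e₁.symm ⁻¹' Ω) ↔
          e₁.symm w ∈ asympCone 4 Ω := by
        constructor
        · intro h x hx t ht
          have := h (e₁ x) (by simpa using hx) t ht
          simpa using this
        · intro h x hx t ht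
          have := h _ hx t ht
          simpa using this
      rw [h1, hu]
      constructor
      · rintro ⟨c, hc0, hw⟩
        rw [LinearEquiv.symm_apply_eq, map_smul, he₁] at hw
        simp [hw, hc0]
      · rintro ⟨hw1, hw2⟩
        refine ⟨w.2, hw2, ?_⟩
        rw [LinearEquiv.symm_apply_eq, map_smul, he₁]
        ext1 <;> simp [hw1]) (hK.image hcont')
    (by rintro _ ⟨k, hk, rfl⟩; simpa using hKΩ hk) (fun p hp => by
      rw [mem_preimage, ← hcov] at hp
      simp only [mem_iUnion] at hp
      obtain ⟨g, hg, k, hk, hgk⟩ := hp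
      obtain ⟨L, hL⟩ := exists_linearEquiv_of_mem_autSet hg k
      refine ⟨e₁ k, ⟨k, hk, rfl⟩, (e₁.symm.trans L).trans e₁, fun v => ?_⟩
      rw [hmem, hmem, map_add, map_add, ← hgk, e₁.symm_apply_apply]
      simpa using hL (e₁.symm v))
  rw [finrank_euclideanSpace_fin] at hform
  obtain ⟨e, φ, c, he⟩ := hform
  exact affinelyEquivalent_paraboloid e₁ e φ c fun x => by simpa using he (e₁ x)
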